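/- Let M be the 6×6 matrix over ℤ[q] with rows: row 1: (q⁴+q³−q²−q, q³−q, q⁵−2q⁴−q³+2q², q⁵−q³, q⁶−2q⁵−q⁴+2q, −2q⁴−q³+2q²+q); row 2: (q³−q, q⁴+q³−q²−q, q⁵−q³, q⁵−2q⁴−q³+2q², q⁶−2q⁵−q⁴+2q, −2q⁴−q³+2q²+q); row 3: (q³−2q², q³, q⁵+q⁴−3q³+3q², q⁵−3q³, q⁶−2q⁵−3q⁴+4q³, −2q⁴+2q³); row 4: (q³, q³−2q², q⁵−3q³, q⁵+q⁴−3q³+3q², q⁶−2q⁵−3q⁴+4q³, −2q⁴+2q³); row 5: (q³, q³, q⁵−3q³, q⁵−3q³, q⁶−2q⁵−2q⁴+4q³+q², −2q⁴); row 6: (−1, −1, 2q², 2q², −4q²+2, q⁴−2q²+2q+1). For g ≥ 0 set v^g = M^g·(1,0,0,0,0,0)ᵗ and write v^g = (ẽ₀^g, ẽ₁^g, ẽ₂^g, ẽ₃^g, ã^g, b̃^g). Then for every g ≥ 1, the identity 2·ẽ₃^g = 2(q³−q)^{2g−1} + (q²+q)^{2g−1} − (q²−q)^{2g−1} holds in ℤ[q].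 -/

import Mathlib

open Polynomial Matrix

noncomputable section

/-- The indeterminate `q` of `ℤ[q]`. -/
def q : Polynomial ℤ := Polynomial.X

/-- The transition matrix `M` of the genus-adding handle attachment. -/
def M : Matrix (Fin 6) (Fin 6) (Polynomial ℤ) :=
  !![q^4+q^3-q^2-q, q^3-q, q^5-2*q^4-q^3+2*q^2, q^5-q^3, q^6-2*q^5-q^4+2*q, -2*q^4-q^3+2*q^2+q;
     q^3-q, q^4+q^3-q^2-q, q^5-q^3, q^5-2*q^4-q^3+2*q^2, q^6-2*q^5-q^4+2*q, -2*q^4-q^3+2*q^2+q;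
     q^3-2*q^2, q^3, q^5+q^4-3*q^3+3*q^2, q^5-3*q^3, q^6-2*q^5-3*q^4+4*q^3, -2*q^4+2*q^3;
     q^3, q^3-2*q^2, q^5-3*q^3, q^5+q^4-3*q^3+3*q^2, q^6-2*q^5-3*q^4+4*q^3, -2*q^4+2*q^3;
     q^3, q^3, q^5-3*q^3, q^5-3*q^3, q^6-2*q^5-2*q^4+4*q^3+q^2, -2*q^4;
     -1, -1, 2*q^2, 2*q^2, -4*q^2+2, q^4-2*q^2+2*q+1]

/-- `v g = M^g · (1,0,0,0,0,0)ᵗ`, whose components are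
`(ẽ₀^g, ẽ₁^g, ẽ₂^g, ẽ₃^g, ã^g, b̃^g)`. -/
def v (g : ℕ) : Fin 6 → Polynomial ℤ :=
  (M ^ g).mulVec ![1, 0, 0, 0, 0, 0]

theorem v_succ (g : ℕ) : v (g + 1) = M.mulVec (v g) := by
  simp only [v, pow_succ', Matrix.mulVec_mulVec]

/-- The general linear combination of the eigenvectors of `M` for the eigenvalues `(q^3-q)^2`,
`(q^2+q)^2`, `(q^2-q)^2`, `(q^2-1)^2` that occur in `v g`, with coefficients `a`, `b`, `c`, `d`. -/
def eigenComb (a b c d : ℤ[X]) : Fin 6 → ℤ[X] :=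
  ![2*a + (q^2-q)*b + (q^2-q-2)*c + 2*q*d,
    2*a + (1-q)*b - (1+q)*c + 2*q*d,
    2*a - q*b + (q-2)*c,
    2*a + b - c,
    2*a + b - c,
    2*d - b - c]

theorem M_mulVec_eigenComb (a b c d : ℤ[X]) :
    M.mulVec (eigenComb a b c d) =
      eigenComb ((q^3-q)^2*a) ((q^2+q)^2*b) ((q^2-q)^2*c) ((q^2-1)^2*d) := by
  ext1 i
  fin_cases i <;>
    simp [M, eigenComb, Matrix.mulVec, dotProduct, Fin.sum_univ_succ] <;> ring

theorem two_smul_v_one :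
    (2 : ℤ[X]) • v 1 = eigenComb (q^3-q) (q^2+q) (q^2-q) (q^2-1) := by
  ext1 i
  fin_cases i <;>
    simp [v, M, eigenComb] <;> ring

theorem two_smul_v_succ (g : ℕ) :
    (2 : ℤ[X]) • v (g + 1) =
      eigenComb ((q^3-q)^(2*g+1)) ((q^2+q)^(2*g+1)) ((q^2-q)^(2*g+1)) ((q^2-1)^(2*g+1)) := by
  induction g with
  | zero => simpa using two_smul_v_one
  | succ g ih =>
    rw [v_succ, ← Matrix.mulVec_smul, ih, M_mulVec_eigenComb]
    simp only [← pow_add]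
    congr 2 <;> ring

theorem stmt_3 (g : ℕ) (hg : 1 ≤ g) :
    2 * v g 3 =
      2*(q^3-q)^(2*g-1) + (q^2+q)^(2*g-1) - (q^2-q)^(2*g-1) := by
  obtain ⟨n, rfl⟩ := Nat.exists_eq_add_of_le' hg
  exact congrFun (two_smul_v_succ n) 3
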